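/- Let d ≥ 2 be an integer and let r, p satisfy 1 ≤ r, 1 < r < p ≤ d. Let b : ℝ^d → [0,∞) be measurable and A ≥ 0 satisfy ∫_B b^p dx ≤ A^p ρ^{d - p} for every ρ > 0 and every ball B of radius ρ. Then for every u ∈ C_0^∞(ℝ^d), ∫_{ℝ^d} b^r |u|^r dx ≤ N A^r ∫_{ℝ^d} |Du|^r dx, where Du is the gradient of u and N depends only on d, r, p. (Chiarenza–Frasca theorem.) -/

import Mathlib

open MeasureTheory Metric ENNReal
open scoped FourierTransform

/-- Riesz potential of an `ℝ≥0∞`-valued function: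
`R_α g (x) = ∫ g(x+y) |y|^(α-d) dy`. -/
noncomputable def riesz {d : ℕ} (α : ℝ) (g : EuclideanSpace ℝ (Fin d) → ℝ≥0∞)
    (x : EuclideanSpace ℝ (Fin d)) : ℝ≥0∞ :=
  ∫⁻ y, g (x + y) * ENNReal.ofReal (‖y‖ ^ (α - (d : ℝ)))

/-- Riesz potential of a real-valued function. -/
noncomputable def rieszR {d : ℕ} (α : ℝ) (f : EuclideanSpace ℝ (Fin d) → ℝ)
    (x : EuclideanSpace ℝ (Fin d)) : ℝ :=
  ∫ y, f (x + y) * ‖y‖ ^ (α - (d : ℝ))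

/-- Hardy–Littlewood maximal function: sup over balls containing `x`
of the average of `g` over the ball. -/
noncomputable def maxFun {d : ℕ} (g : EuclideanSpace ℝ (Fin d) → ℝ≥0∞)
    (x : EuclideanSpace ℝ (Fin d)) : ℝ≥0∞ :=
  ⨆ (z : EuclideanSpace ℝ (Fin d)) (r : ℝ) (_ : x ∈ ball z r),
    (∫⁻ y in ball z r, g y) / volume (ball z r)

section MaximalFunction

variable {d : ℕ}

theorem volume_ball_eq (x : EuclideanSpace ℝ (Fin d)) {t : ℝ} (ht : 0 < t) :
    volume (ball x t) =
      ENNReal.ofReal (t ^ d) * volume (ball (0 : EuclideanSpace ℝ (Fin d)) 1) := by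
  simpa using Measure.addHaar_ball_of_pos (volume : Measure (EuclideanSpace ℝ (Fin d))) x ht

theorem lt_maxFun_iff {g : EuclideanSpace ℝ (Fin d) → ℝ≥0∞} {x : EuclideanSpace ℝ (Fin d)}
    {l : ℝ≥0∞} :
    l < maxFun g x ↔
      ∃ z t, x ∈ ball z t ∧ l < (∫⁻ y in ball z t, g y) / volume (ball z t) := by
  simp [maxFun, lt_iSup_iff]

theorem average_le_maxFun (g : EuclideanSpace ℝ (Fin d) → ℝ≥0∞) {x z : EuclideanSpace ℝ (Fin d)}
    {t : ℝ} (hx : x ∈ ball z t) :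
    (∫⁻ y in ball z t, g y) / volume (ball z t) ≤ maxFun g x :=
  le_iSup_of_le z (le_iSup_of_le t (le_iSup_of_le hx le_rfl))

theorem setLIntegral_ball_le_maxFun (g : EuclideanSpace ℝ (Fin d) → ℝ≥0∞)
    {x z : EuclideanSpace ℝ (Fin d)} {t : ℝ} (hx : x ∈ ball z t) :
    ∫⁻ y in ball z t, g y ≤ maxFun g x * volume (ball z t) := by
  have ht : 0 < t := pos_of_mem_ball hx
  rw [← ENNReal.div_le_iff (measure_ball_pos _ _ ht).ne' measure_ball_lt_top.ne]
  exact average_le_maxFun g hx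

theorem isOpen_lt_maxFun (g : EuclideanSpace ℝ (Fin d) → ℝ≥0∞) (l : ℝ≥0∞) :
    IsOpen {x | l < maxFun g x} := by
  rw [isOpen_iff_forall_mem_open]
  intro x hx
  obtain ⟨z, t, hxz, hl⟩ := lt_maxFun_iff.1 hx
  exact ⟨ball z t, fun y hy => lt_maxFun_iff.2 ⟨z, t, hy, hl⟩, isOpen_ball, hxz⟩

theorem measurable_maxFun (g : EuclideanSpace ℝ (Fin d) → ℝ≥0∞) : Measurable (maxFun g) :=
  measurable_of_Ioi fun l => (isOpen_lt_maxFun g l).measurableSet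

/-- Weak type `(1, 1)` bound for the maximal function. -/
theorem mul_volume_lt_maxFun_le (hd : d ≠ 0) (g : EuclideanSpace ℝ (Fin d) → ℝ≥0∞)
    (hg : ∫⁻ x, g x ≠ ∞) {l : ℝ≥0∞} (hl0 : l ≠ 0) (hl : l ≠ ∞) :
    l * volume {x | l < maxFun g x} ≤ 5 ^ d * ∫⁻ x, g x := by
  set S := {x | l < maxFun g x}
  have hS : ∀ x ∈ S, ∃ q : EuclideanSpace ℝ (Fin d) × ℝ, x ∈ ball q.1 q.2 ∧
      l < (∫⁻ y in ball q.1 q.2, g y) / volume (ball q.1 q.2) := fun x hx => by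
    obtain ⟨z, t, h⟩ := lt_maxFun_iff.1 hx
    exact ⟨(z, t), h⟩
  set T : Set (EuclideanSpace ℝ (Fin d) × ℝ) :=
    {q | 0 < q.2 ∧ l < (∫⁻ y in ball q.1 q.2, g y) / volume (ball q.1 q.2)}
  have hT : ∀ q ∈ T, l * volume (ball q.1 q.2) ≤ ∫⁻ y in ball q.1 q.2, g y := fun q hq =>
    (ENNReal.le_div_iff_mul_le (Or.inl (measure_ball_pos _ _ hq.1).ne')
      (Or.inl measure_ball_lt_top.ne)).1 hq.2.le
  set ω := volume (ball (0 : EuclideanSpace ℝ (Fin d)) 1)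
  have hω0 : ω ≠ 0 := (measure_ball_pos _ _ one_pos).ne'
  have hω : ω ≠ ∞ := measure_ball_lt_top.ne
  have hR : ∀ q ∈ T, q.2 ≤ max 1 ((∫⁻ x, g x) / (l * ω)).toReal := by
    intro q hq
    by_cases h1 : q.2 ≤ 1
    · exact le_max_of_le_left h1
    refine le_max_of_le_right ?_
    push Not at h1
    refine (ENNReal.ofReal_le_iff_le_toReal (ENNReal.div_ne_top hg (mul_ne_zero hl0 hω0))).1 ?_
    rw [ENNReal.le_div_iff_mul_le (Or.inl (mul_ne_zero hl0 hω0)) (Or.inl (ENNReal.mul_ne_top hl hω))]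
    calc ENNReal.ofReal q.2 * (l * ω) ≤ ENNReal.ofReal (q.2 ^ d) * (l * ω) := by
          gcongr
          exact le_self_pow₀ h1.le hd
      _ = l * volume (ball q.1 q.2) := by rw [volume_ball_eq _ hq.1]; ring
      _ ≤ ∫⁻ y in ball q.1 q.2, g y := hT q hq
      _ ≤ ∫⁻ y, g y := setLIntegral_le_lintegral _ _
  obtain ⟨u, huT, hdisj, hcov⟩ := Vitali.exists_disjoint_subfamily_covering_enlargement_closedBall
    T (fun q => q.1) (fun q => q.2) _ hR 5 (by norm_num)
  have hdisj' : u.PairwiseDisjoint fun q => ball q.1 q.2 :=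
    hdisj.mono_on fun q _ => ball_subset_closedBall
  have hu : u.Countable := hdisj'.countable_of_isOpen (fun _ _ => isOpen_ball)
    fun q hq => nonempty_ball.2 (huT hq).1
  have hsub : S ⊆ ⋃ q ∈ u, closedBall q.1 (5 * q.2) := by
    intro x hx
    obtain ⟨q, hxq, hq⟩ := hS x hx
    obtain ⟨q', hq', hsub⟩ := hcov q ⟨pos_of_mem_ball hxq, hq⟩
    exact Set.mem_biUnion hq' (hsub (ball_subset_closedBall hxq))
  calc l * volume S ≤ l * ∑' q : u, volume (closedBall q.1.1 (5 * q.1.2)) := by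
        gcongr
        exact (measure_mono hsub).trans (measure_biUnion_le _ hu _)
    _ = 5 ^ d * ∑' q : u, l * volume (ball q.1.1 q.1.2) := by
        rw [← ENNReal.tsum_mul_left, ← ENNReal.tsum_mul_left]
        congr 1 with q
        have hq := (huT q.2).1
        have h5 : volume (closedBall q.1.1 (5 * q.1.2)) =
            ENNReal.ofReal (5 ^ d) * volume (ball q.1.1 q.1.2) := by
          rw [volume_ball_eq _ hq, Measure.addHaar_closedBall _ _ (by positivity)]
          simp only [finrank_euclideanSpace, Fintype.card_fin]
          rw [mul_pow, ENNReal.ofReal_mul (by positivity), mul_assoc]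
        rw [h5, ENNReal.ofReal_pow (by norm_num)]
        norm_num
        ring
    _ ≤ 5 ^ d * ∑' q : u, ∫⁻ y in ball q.1.1 q.1.2, g y := by
        gcongr with q
        exact hT q.1 (huT q.2)
    _ = 5 ^ d * ∫⁻ y in ⋃ q ∈ u, ball q.1 q.2, g y := by
        rw [lintegral_biUnion hu (fun _ _ => measurableSet_ball) hdisj']
    _ ≤ 5 ^ d * ∫⁻ x, g x := by
        gcongr
        exact Measure.restrict_le_self

theorem ae_le_maxFun {g : EuclideanSpace ℝ (Fin d) → ℝ≥0∞} (hgm : Measurable g)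
    (hg : ∀ x, ∃ t, 0 < t ∧ ∫⁻ y in ball x t, g y ≠ ∞) : ∀ᵐ x, g x ≤ maxFun g x := by
  have : IsLocallyFiniteMeasure (volume.withDensity g) := ⟨fun x => by
    obtain ⟨t, ht, h⟩ := hg x
    refine ⟨ball x t, ball_mem_nhds x ht, ?_⟩
    rw [withDensity_apply _ measurableSet_ball]
    exact h.lt_top⟩
  filter_upwards [Besicovitch.ae_tendsto_rnDeriv (volume.withDensity g) volume,
    Measure.rnDeriv_withDensity volume hgm] with x hx hgx
  rw [hgx] at hx
  refine le_of_tendsto hx ?_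
  filter_upwards [self_mem_nhdsWithin] with t ht
  have ht : 0 < t := ht
  have h0 : volume (closedBall x t) = volume (ball x t) := by
    rw [volume_ball_eq _ ht, Measure.addHaar_closedBall _ _ ht.le]
    simp
  have h1 : (ball x t : Set _) =ᵐ[volume] closedBall x t :=
    ae_eq_of_subset_of_measure_ge ball_subset_closedBall h0.le
      measurableSet_ball.nullMeasurableSet measure_closedBall_lt_top.ne
  rw [withDensity_apply _ measurableSet_closedBall, ← setLIntegral_congr h1, h0]
  exact average_le_maxFun g (mem_ball_self ht)

theorem rpow_le_add_tsum_dyadic {δ : ℝ} (hδ : 0 < δ) (a : ℝ≥0∞) {l : ℝ≥0∞} (hl0 : l ≠ 0)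
    (hl : l ≠ ∞) :
    a ^ δ ≤ l ^ δ + ∑' k : ℕ, {b | 2 ^ k * l < b}.indicator (fun _ => (2 ^ (k + 1) * l) ^ δ) a := by
  rcases eq_or_ne a ∞ with rfl | ha
  · have h : ∑' k : ℕ, {b : ℝ≥0∞ | 2 ^ k * l < b}.indicator
        (fun _ => (2 ^ (k + 1) * l) ^ δ) ∞ = ∞ := by
      refine top_unique ?_
      calc ∞ = ∑' _ : ℕ, l ^ δ :=
            (ENNReal.tsum_const_eq_top_of_ne_zero
              (ENNReal.rpow_pos (pos_iff_ne_zero.2 hl0) hl).ne').symm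
        _ ≤ _ := by
            gcongr with k
            have hk : (2 : ℝ≥0∞) ^ k * l < ∞ :=
              ENNReal.mul_lt_top (ENNReal.pow_lt_top (by simp)) hl.lt_top
            rw [Set.indicator_of_mem (by exact hk)]
            gcongr
            exact le_mul_of_one_le_left' (one_le_pow₀ one_le_two)
    rw [h]
    simp
  by_cases hal : a ≤ l
  · exact le_add_right (by gcongr)
  push Not at hal
  have hex : ∃ n : ℕ, a ≤ 2 ^ n * l := by
    obtain ⟨n, hn⟩ := ENNReal.exists_nat_mul_gt hl0 ha
    refine ⟨n, hn.le.trans ?_⟩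
    gcongr
    exact_mod_cast Nat.lt_two_pow_self.le
  obtain ⟨m, hm⟩ : ∃ m, Nat.find hex = m + 1 := Nat.exists_eq_succ_of_ne_zero fun h0 => by
    have := Nat.find_spec hex
    rw [h0, pow_zero, one_mul] at this
    exact absurd this (not_le.2 hal)
  have h1 : a ≤ 2 ^ (m + 1) * l := hm ▸ Nat.find_spec hex
  have h2 : 2 ^ m * l < a := not_le.1 (Nat.find_min hex (by omega))
  refine le_add_left (le_trans ?_ (ENNReal.le_tsum m))
  rw [Set.indicator_of_mem (by exact h2)]
  gcongr

theorem tsum_dyadic_ne_top {δ : ℝ} (hδ : 0 < δ) (hδ1 : δ < 1) :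
    ∑' k : ℕ, ((2 : ℝ≥0∞) ^ (k + 1)) ^ δ / 2 ^ k ≠ ∞ := by
  have h : ∀ k : ℕ, ((2 : ℝ≥0∞) ^ (k + 1)) ^ δ / 2 ^ k = 2 ^ δ * (2 ^ (δ - 1)) ^ k := by
    intro k
    rw [pow_succ, ENNReal.mul_rpow_of_nonneg _ _ hδ.le, ENNReal.rpow_sub _ _ (by simp) (by simp),
      ENNReal.rpow_one, div_eq_mul_inv, div_eq_mul_inv, mul_pow, ENNReal.inv_pow,
      ← ENNReal.rpow_natCast, ← ENNReal.rpow_mul, mul_comm (k : ℝ) δ, ENNReal.rpow_mul,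
      ENNReal.rpow_natCast]
    ring
  simp_rw [h]
  rw [ENNReal.tsum_mul_left, ENNReal.tsum_geometric]
  refine ENNReal.mul_ne_top (ENNReal.rpow_ne_top_of_nonneg hδ.le (by simp)) ?_
  rw [ENNReal.inv_ne_top]
  exact (tsub_pos_of_lt
    (ENNReal.rpow_lt_one_of_one_lt_of_neg one_lt_two (by linarith))).ne'

/-- Kolmogorov's inequality: the maximal function of an integrable function is locally in `L^δ`
for `δ < 1`. -/
theorem setLIntegral_maxFun_rpow_le (hd : d ≠ 0) {δ : ℝ} (hδ : 0 < δ)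
    (g : EuclideanSpace ℝ (Fin d) → ℝ≥0∞) (hg : ∫⁻ x, g x ≠ ∞) {l : ℝ≥0∞} (hl0 : l ≠ 0)
    (hl : l ≠ ∞) (B : Set (EuclideanSpace ℝ (Fin d))) :
    ∫⁻ x in B, maxFun g x ^ δ ≤ l ^ δ * volume B +
      l ^ δ * ((∑' k : ℕ, ((2 : ℝ≥0∞) ^ (k + 1)) ^ δ / 2 ^ k) * (5 ^ d * ((∫⁻ x, g x) / l))) := by
  have hms : ∀ k : ℕ, MeasurableSet {x | 2 ^ k * l < maxFun g x} :=
    fun k => (isOpen_lt_maxFun g _).measurableSet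
  calc ∫⁻ x in B, maxFun g x ^ δ
      ≤ ∫⁻ x in B, (l ^ δ + ∑' k : ℕ, {x | 2 ^ k * l < maxFun g x}.indicator
          (fun _ => (2 ^ (k + 1) * l) ^ δ) x) :=
        lintegral_mono fun x => rpow_le_add_tsum_dyadic hδ (maxFun g x) hl0 hl
    _ = l ^ δ * volume B + ∑' k : ℕ, ∫⁻ x in B, {x | 2 ^ k * l < maxFun g x}.indicator
          (fun _ => (2 ^ (k + 1) * l) ^ δ) x := by
        rw [lintegral_add_left measurable_const, setLIntegral_const, lintegral_tsum]
        exact fun k => (measurable_const.indicator (hms k)).aemeasurable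
    _ ≤ l ^ δ * volume B + ∑' k : ℕ,
          l ^ δ * ((((2 : ℝ≥0∞) ^ (k + 1)) ^ δ / 2 ^ k) * (5 ^ d * ((∫⁻ x, g x) / l))) := by
        gcongr with k
        have hk0 : (2 : ℝ≥0∞) ^ k * l ≠ 0 := mul_ne_zero (by simp) hl0
        have hk : (2 : ℝ≥0∞) ^ k * l ≠ ∞ := ENNReal.mul_ne_top (by simp) hl
        have hw : volume {x | 2 ^ k * l < maxFun g x} ≤ 5 ^ d * (∫⁻ x, g x) / (2 ^ k * l) := by
          rw [ENNReal.le_div_iff_mul_le (Or.inl hk0) (Or.inl hk), mul_comm]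
          exact mul_volume_lt_maxFun_le hd g hg hk0 hk
        calc ∫⁻ x in B, {x | 2 ^ k * l < maxFun g x}.indicator (fun _ => (2 ^ (k + 1) * l) ^ δ) x
            ≤ ∫⁻ x, {x | 2 ^ k * l < maxFun g x}.indicator (fun _ => (2 ^ (k + 1) * l) ^ δ) x :=
              setLIntegral_le_lintegral _ _
          _ = (2 ^ (k + 1) * l) ^ δ * volume {x | 2 ^ k * l < maxFun g x} :=
              lintegral_indicator_const (hms k) _
          _ ≤ (2 ^ (k + 1) * l) ^ δ * (5 ^ d * (∫⁻ x, g x) / (2 ^ k * l)) := by gcongr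
          _ = _ := by
              rw [ENNReal.mul_rpow_of_nonneg _ _ hδ.le]
              simp only [div_eq_mul_inv]
              rw [ENNReal.mul_inv (Or.inr hl) (Or.inr hl0)]
              ring
    _ = _ := by rw [ENNReal.tsum_mul_left, ENNReal.tsum_mul_right]

theorem maxFun_le_add {g : EuclideanSpace ℝ (Fin d) → ℝ≥0∞} {x₀ : EuclideanSpace ℝ (Fin d)}
    {ρ : ℝ} {K : ℝ≥0∞}
    (hK : ∀ s, ρ ≤ s → ∫⁻ y in ball x₀ s, g y ≤ K * volume (ball x₀ s))
    {x : EuclideanSpace ℝ (Fin d)} (hx : x ∈ ball x₀ ρ) :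
    maxFun g x ≤ maxFun ((ball x₀ (2 * ρ)).indicator g) x + 4 ^ d * K := by
  refine iSup_le fun z => iSup_le fun t => iSup_le fun hxz => ?_
  have ht : 0 < t := pos_of_mem_ball hxz
  rw [mem_ball] at hx hxz
  have hsub : ball z t ⊆ ball x₀ (2 * t + ρ) := fun y hy => by
    rw [mem_ball] at hy ⊢
    have h1 := dist_triangle y z x
    have h2 := dist_triangle y x x₀
    rw [dist_comm z x] at h1
    linarith
  by_cases htρ : t ≤ ρ / 2
  · refine le_add_right (le_trans ?_ (average_le_maxFun _ hxz))
    gcongr 1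
    refine setLIntegral_mono_ae' measurableSet_ball (.of_forall fun y hy => ?_)
    rw [Set.indicator_of_mem]
    exact ball_subset_ball (by linarith) (hsub hy)
  · push Not at htρ
    refine le_add_left ?_
    rw [ENNReal.div_le_iff (measure_ball_pos _ _ ht).ne' measure_ball_lt_top.ne]
    calc ∫⁻ y in ball z t, g y ≤ ∫⁻ y in ball x₀ (4 * t), g y :=
          lintegral_mono_set (hsub.trans (ball_subset_ball (by linarith)))
      _ ≤ K * volume (ball x₀ (4 * t)) := hK _ (by linarith)
      _ = 4 ^ d * K * volume (ball z t) := by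
          rw [volume_ball_eq _ ht, volume_ball_eq _ (by positivity : 0 < 4 * t), mul_pow,
            ENNReal.ofReal_mul (by positivity), ENNReal.ofReal_pow (by norm_num)]
          norm_num
          ring

/-- If all averages of `g` over balls centred at `x₀` with radius at least `ρ` are bounded by `K`,
then the average of `(maxFun g) ^ δ` over the ball of radius `ρ` is bounded by a multiple
of `K ^ δ`. -/
theorem exists_setLIntegral_ball_maxFun_rpow_le (hd : d ≠ 0) {δ : ℝ} (hδ : 0 < δ) (hδ1 : δ < 1) :
    ∃ C : ℝ≥0∞, C ≠ ∞ ∧ ∀ (g : EuclideanSpace ℝ (Fin d) → ℝ≥0∞)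
      (x₀ : EuclideanSpace ℝ (Fin d)) (ρ : ℝ) (K : ℝ≥0∞), 0 < ρ → K ≠ 0 → K ≠ ∞ →
      (∀ s, ρ ≤ s → ∫⁻ y in ball x₀ s, g y ≤ K * volume (ball x₀ s)) →
      ∫⁻ x in ball x₀ ρ, maxFun g x ^ δ ≤ C * (K ^ δ * volume (ball x₀ ρ)) := by
  set D := ∑' k : ℕ, ((2 : ℝ≥0∞) ^ (k + 1)) ^ δ / 2 ^ k
  have hD : D ≠ ∞ := tsum_dyadic_ne_top hδ hδ1
  refine ⟨1 + D * 10 ^ d + (4 ^ d) ^ δ, ?_, ?_⟩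
  · have h4 : ((4 : ℝ≥0∞) ^ d) ^ δ ≠ ∞ := ENNReal.rpow_ne_top_of_nonneg hδ.le (by simp)
    have h10 : D * 10 ^ d ≠ ∞ := ENNReal.mul_ne_top hD (by simp)
    simp [h4, h10]
  intro g x₀ ρ K hρ hK0 hKtop hK
  set f := (ball x₀ (2 * ρ)).indicator g
  have hf : ∫⁻ x, f x ≤ K * (2 ^ d * volume (ball x₀ ρ)) := by
    rw [lintegral_indicator measurableSet_ball]
    refine (hK _ (by linarith)).trans_eq ?_
    rw [volume_ball_eq _ hρ, volume_ball_eq _ (by positivity : 0 < 2 * ρ), mul_pow,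
      ENNReal.ofReal_mul (by positivity), ENNReal.ofReal_pow (by norm_num)]
    norm_num
    ring
  have hf' : ∫⁻ x, f x ≠ ∞ := ne_top_of_le_ne_top
    (ENNReal.mul_ne_top hKtop (ENNReal.mul_ne_top (by simp) measure_ball_lt_top.ne)) hf
  calc ∫⁻ x in ball x₀ ρ, maxFun g x ^ δ
      ≤ ∫⁻ x in ball x₀ ρ, (maxFun f x ^ δ + (4 ^ d * K) ^ δ) := by
        refine setLIntegral_mono_ae' measurableSet_ball (.of_forall fun x hx => ?_)
        exact (ENNReal.rpow_le_rpow (maxFun_le_add hK hx) hδ.le).trans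
          (ENNReal.rpow_add_le_add_rpow _ _ hδ.le hδ1.le)
    _ = (∫⁻ x in ball x₀ ρ, maxFun f x ^ δ) + (4 ^ d * K) ^ δ * volume (ball x₀ ρ) := by
        rw [lintegral_add_right _ measurable_const, setLIntegral_const]
    _ ≤ (K ^ δ * volume (ball x₀ ρ) +
          K ^ δ * (D * (5 ^ d * (K * (2 ^ d * volume (ball x₀ ρ)) / K)))) +
          (4 ^ d * K) ^ δ * volume (ball x₀ ρ) := by
        gcongr
        refine (setLIntegral_maxFun_rpow_le hd hδ f hf' hK0 hKtop _).trans ?_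
        gcongr
    _ = _ := by
        rw [mul_comm K (2 ^ d * _), ENNReal.mul_div_cancel_right hK0 hKtop,
          ENNReal.mul_rpow_of_nonneg _ _ hδ.le,
          show (10 : ℝ≥0∞) = 5 * 2 by norm_num, mul_pow]
        ring

end MaximalFunction

section BallPotential

variable {d : ℕ}

/-- The potential `x ↦ ∫₀^∞ t⁻ᵈ ∫_{B(x, t)} g dt`, a constant multiple of the Riesz potential
of order one. -/
noncomputable def ballPotential (g : EuclideanSpace ℝ (Fin d) → ℝ≥0∞)
    (x : EuclideanSpace ℝ (Fin d)) : ℝ≥0∞ :=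
  ∫⁻ t in Set.Ioi (0 : ℝ), (ENNReal.ofReal (t ^ d))⁻¹ * ∫⁻ y in ball x t, g y

theorem measurableSet_dist_lt :
    MeasurableSet {q : (ℝ × EuclideanSpace ℝ (Fin d)) × EuclideanSpace ℝ (Fin d) |
      dist q.2 q.1.2 < q.1.1} :=
  measurableSet_lt (by fun_prop) (by fun_prop)

theorem measurable_setLIntegral_ball {g : EuclideanSpace ℝ (Fin d) → ℝ≥0∞} (hg : Measurable g) :
    Measurable fun q : ℝ × EuclideanSpace ℝ (Fin d) => ∫⁻ y in ball q.2 q.1, g y := by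
  have h := ((hg.comp measurable_snd).indicator
    (measurableSet_dist_lt (d := d))).lintegral_prod_right' (ν := volume)
  simp_rw [← lintegral_indicator measurableSet_ball]
  exact h

theorem lintegral_mul_setLIntegral_ball_comm {f g : EuclideanSpace ℝ (Fin d) → ℝ≥0∞}
    (hf : Measurable f) (hg : Measurable g) (t : ℝ) :
    ∫⁻ x, f x * ∫⁻ y in ball x t, g y = ∫⁻ y, g y * ∫⁻ x in ball y t, f x := by
  have hS : MeasurableSet {q : EuclideanSpace ℝ (Fin d) × EuclideanSpace ℝ (Fin d) |
      dist q.2 q.1 < t} := measurableSet_lt (by fun_prop) (by fun_prop)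
  have key : ∀ f g : EuclideanSpace ℝ (Fin d) → ℝ≥0∞, Measurable g → ∀ x,
      f x * ∫⁻ y in ball x t, g y = ∫⁻ y, {q : EuclideanSpace ℝ (Fin d) ×
        EuclideanSpace ℝ (Fin d) | dist q.2 q.1 < t}.indicator (fun q => f q.1 * g q.2) (x, y) := by
    intro f g hg x
    rw [← lintegral_indicator measurableSet_ball,
      ← lintegral_const_mul _ (hg.indicator measurableSet_ball)]
    refine lintegral_congr fun y => ?_
    by_cases h : dist y x < t
    · simp [Set.indicator, h]
    · simp [Set.indicator, h]
  simp_rw [key f g hg, key g f hf]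
  have hm : Measurable fun q : EuclideanSpace ℝ (Fin d) × EuclideanSpace ℝ (Fin d) =>
      f q.1 * g q.2 := (hf.comp measurable_fst).mul (hg.comp measurable_snd)
  have hm' := (hm.indicator hS).aemeasurable (μ := volume.prod volume)
  rw [lintegral_lintegral_swap (by exact hm')]
  refine lintegral_congr fun y => lintegral_congr fun x => ?_
  simp [Set.indicator, dist_comm, mul_comm]

theorem lintegral_mul_lintegral_mul_swap {α β : Type*} [MeasurableSpace α] [MeasurableSpace β]
    {μ : Measure α} {ν : Measure β} [SFinite μ] [SFinite ν] {f : α → ℝ≥0∞} {c : β → ℝ≥0∞}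
    {F : β × α → ℝ≥0∞} (hf : Measurable f) (hc : Measurable c) (hF : Measurable F) :
    ∫⁻ x, f x * ∫⁻ t, c t * F (t, x) ∂ν ∂μ = ∫⁻ t, c t * ∫⁻ x, f x * F (t, x) ∂μ ∂ν := by
  have hm : Measurable fun q : α × β => f q.1 * (c q.2 * F (q.2, q.1)) := by fun_prop
  calc ∫⁻ x, f x * ∫⁻ t, c t * F (t, x) ∂ν ∂μ
      = ∫⁻ x, ∫⁻ t, f x * (c t * F (t, x)) ∂ν ∂μ := by
        refine lintegral_congr fun x => ?_
        rw [lintegral_const_mul _ (by fun_prop)]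
    _ = ∫⁻ t, ∫⁻ x, f x * (c t * F (t, x)) ∂μ ∂ν := lintegral_lintegral_swap hm.aemeasurable
    _ = _ := by
        refine lintegral_congr fun t => ?_
        rw [← lintegral_const_mul _ (by fun_prop)]
        exact lintegral_congr fun x => mul_left_comm _ _ _

theorem lintegral_mul_ballPotential_comm {f g : EuclideanSpace ℝ (Fin d) → ℝ≥0∞}
    (hf : Measurable f) (hg : Measurable g) :
    ∫⁻ x, f x * ballPotential g x = ∫⁻ y, g y * ballPotential f y := by
  have hc : Measurable fun t : ℝ => (ENNReal.ofReal (t ^ d))⁻¹ := by fun_prop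
  have hfg := lintegral_mul_lintegral_mul_swap (μ := volume)
    (ν := volume.restrict (Set.Ioi (0 : ℝ))) hf hc (measurable_setLIntegral_ball hg)
  have hgf := lintegral_mul_lintegral_mul_swap (μ := volume)
    (ν := volume.restrict (Set.Ioi (0 : ℝ))) hg hc (measurable_setLIntegral_ball hf)
  refine hfg.trans (Eq.trans ?_ hgf.symm)
  refine lintegral_congr fun t => ?_
  rw [lintegral_mul_setLIntegral_ball_comm hf hg]

theorem setLIntegral_unitBall_comp_smul {g : EuclideanSpace ℝ (Fin d) → ℝ≥0∞} (hg : Measurable g)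
    (x : EuclideanSpace ℝ (Fin d)) {t : ℝ} (ht : 0 < t) :
    ∫⁻ θ in ball (0 : EuclideanSpace ℝ (Fin d)) 1, g (x + t • θ) =
      (ENNReal.ofReal (t ^ d))⁻¹ * ∫⁻ y in ball x t, g y := by
  set h : EuclideanSpace ℝ (Fin d) → ℝ≥0∞ := (ball x t).indicator g
  have hh : Measurable h := hg.indicator measurableSet_ball
  have hθ : ∀ θ, (ball (0 : EuclideanSpace ℝ (Fin d)) 1).indicator (fun θ => g (x + t • θ)) θ =
      h (x + t • θ) := fun θ => by
    have : ‖t • θ‖ < t ↔ ‖θ‖ < 1 := by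
      rw [norm_smul, Real.norm_of_nonneg ht.le]
      exact mul_lt_iff_lt_one_right ht
    simp [h, Set.indicator, this]
  rw [← lintegral_indicator measurableSet_ball, ← lintegral_indicator measurableSet_ball,
    lintegral_congr hθ]
  have hmap := Measure.map_addHaar_smul
    (volume : Measure (EuclideanSpace ℝ (Fin d))) ht.ne'
  calc ∫⁻ θ, h (x + t • θ)
      = ∫⁻ y, h (x + y) ∂(Measure.map (t • ·) (volume : Measure (EuclideanSpace ℝ (Fin d)))) :=
        (lintegral_map (hh.comp (measurable_const_add x)) (measurable_const_smul t)).symm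
    _ = _ := by
        rw [hmap, lintegral_smul_measure, lintegral_add_left_eq_self]
        simp only [finrank_euclideanSpace, Fintype.card_fin, smul_eq_mul]
        rw [abs_of_pos (by positivity), ENNReal.ofReal_inv_of_pos (by positivity)]

theorem enorm_le_lintegral_ray {v : EuclideanSpace ℝ (Fin d) → ℝ} (hv : ContDiff ℝ 1 v)
    (hv' : HasCompactSupport v) (x : EuclideanSpace ℝ (Fin d)) {θ : EuclideanSpace ℝ (Fin d)}
    (hθ0 : θ ≠ 0) (hθ : ‖θ‖ ≤ 1) :
    ‖v x‖ₑ ≤ ∫⁻ t in Set.Ioi (0 : ℝ), ‖fderiv ℝ v (x + t • θ)‖ₑ := by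
  set φ : ℝ → EuclideanSpace ℝ (Fin d) := fun s => x + s • (-θ)
  have hφ : ContDiff ℝ 1 φ := by fun_prop
  have hemb : Topology.IsClosedEmbedding φ :=
    (Homeomorph.addLeft x).isClosedEmbedding.comp
      (isClosedEmbedding_smul_left (neg_ne_zero.2 hθ0))
  have h := HasCompactSupport.enorm_le_lintegral_Ici_deriv (hv.comp hφ)
    (hv'.comp_isClosedEmbedding hemb) 0
  have h0 : φ 0 = x := by simp [φ]
  rw [Function.comp_apply, h0] at h
  refine h.trans ?_
  have hd : ∀ s, ‖deriv (v ∘ φ) s‖ₑ ≤ ‖fderiv ℝ v (φ s)‖ₑ := by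
    intro s
    have hφ' : HasDerivAt φ (-θ) s := by
      have h := ((hasDerivAt_id s).smul_const (-θ)).const_add x
      rw [one_smul] at h
      exact h
    rw [((hv.differentiable one_ne_zero (φ s)).hasFDerivAt.comp_hasDerivAt s hφ').deriv]
    refine (ContinuousLinearMap.le_opENorm _ _).trans ?_
    refine mul_le_of_le_one_right' ?_
    rw [enorm_neg, ← ofReal_norm]
    exact ENNReal.ofReal_le_one.2 hθ
  calc ∫⁻ s in Set.Iic (0 : ℝ), ‖deriv (v ∘ φ) s‖ₑ
      ≤ ∫⁻ s in Set.Iic (0 : ℝ), ‖fderiv ℝ v (φ s)‖ₑ := lintegral_mono hd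
    _ = ∫⁻ s in Set.Iio (0 : ℝ), ‖fderiv ℝ v (φ s)‖ₑ := by
        rw [setLIntegral_congr Iio_ae_eq_Iic]
    _ = ∫⁻ t in Set.Ioi (0 : ℝ), ‖fderiv ℝ v (x + t • θ)‖ₑ := by
        rw [← (Measure.measurePreserving_neg (volume : Measure ℝ)).setLIntegral_comp_preimage_emb
          (MeasurableEquiv.neg ℝ).measurableEmbedding]
        simp [φ]

/-- A compactly supported `C¹` function is dominated by the potential of its gradient. -/
theorem enorm_mul_volume_le_ballPotential (hd : d ≠ 0) {v : EuclideanSpace ℝ (Fin d) → ℝ}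
    (hv : ContDiff ℝ 1 v) (hv' : HasCompactSupport v) (x : EuclideanSpace ℝ (Fin d)) :
    ‖v x‖ₑ * volume (ball (0 : EuclideanSpace ℝ (Fin d)) 1) ≤
      ballPotential (fun y => ‖fderiv ℝ v y‖ₑ) x := by
  have hc : Continuous (fderiv ℝ v) := hv.continuous_fderiv one_ne_zero
  have : Nonempty (Fin d) := ⟨⟨0, Nat.pos_of_ne_zero hd⟩⟩
  calc ‖v x‖ₑ * volume (ball (0 : EuclideanSpace ℝ (Fin d)) 1)
      = ∫⁻ _ in ball (0 : EuclideanSpace ℝ (Fin d)) 1, ‖v x‖ₑ := by rw [setLIntegral_const]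
    _ ≤ ∫⁻ θ in ball (0 : EuclideanSpace ℝ (Fin d)) 1,
          ∫⁻ t in Set.Ioi (0 : ℝ), ‖fderiv ℝ v (x + t • θ)‖ₑ := by
        have h0 : ∀ᵐ θ : EuclideanSpace ℝ (Fin d), θ ≠ 0 := by simp [ae_iff]
        refine setLIntegral_mono_ae' measurableSet_ball ?_
        filter_upwards [h0] with θ hθ0 hθ
        exact enorm_le_lintegral_ray hv hv' x hθ0 (mem_ball_zero_iff.1 hθ).le
    _ = ∫⁻ t in Set.Ioi (0 : ℝ), ∫⁻ θ in ball (0 : EuclideanSpace ℝ (Fin d)) 1,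
          ‖fderiv ℝ v (x + t • θ)‖ₑ := by
        rw [lintegral_lintegral_swap]
        refine Continuous.aemeasurable ?_
        simp only [Function.uncurry_def]
        fun_prop
    _ = ballPotential (fun y => ‖fderiv ℝ v y‖ₑ) x := by
        refine setLIntegral_congr_fun measurableSet_Ioi fun t ht => ?_
        exact setLIntegral_unitBall_comp_smul (g := fun y => ‖fderiv ℝ v y‖ₑ)
          hc.enorm.measurable x ht

theorem lintegral_Ioi_rpow_neg {r R : ℝ} (hr : 1 < r) (hR : 0 < R) :
    ∫⁻ t in Set.Ioi R, ENNReal.ofReal (t ^ (-r)) = ENNReal.ofReal (R ^ (1 - r) / (r - 1)) := by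
  rw [← ofReal_integral_eq_lintegral_ofReal (integrableOn_Ioi_rpow_of_lt (by linarith) hR),
    integral_Ioi_rpow_of_lt (by linarith) hR]
  · rw [show -r + 1 = -(r - 1) by ring, neg_div_neg_eq, neg_sub]
  · filter_upwards [ae_restrict_mem measurableSet_Ioi] with t ht
    exact Real.rpow_nonneg (hR.le.trans ht.le) _

/-- Hedberg's estimate: near the centre the potential is controlled by the averages, far away
by the Morrey condition. -/
theorem ballPotential_le {g : EuclideanSpace ℝ (Fin d) → ℝ≥0∞} {x : EuclideanSpace ℝ (Fin d)}
    {r R : ℝ} (hr : 1 < r) (hR : 0 < R) {P Q : ℝ≥0∞}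
    (hP : ∀ t, 0 < t → ∫⁻ y in ball x t, g y ≤ ENNReal.ofReal (t ^ d) * P)
    (hQ : ∀ t, 0 < t →
      ∫⁻ y in ball x t, g y ≤ ENNReal.ofReal (t ^ d) * (Q * ENNReal.ofReal (t ^ (-r)))) :
    ballPotential g x ≤ P * ENNReal.ofReal R + Q * ENNReal.ofReal (R ^ (1 - r) / (r - 1)) := by
  have hcancel : ∀ t, 0 < t → ∀ a b : ℝ≥0∞, a ≤ ENNReal.ofReal (t ^ d) * b →
      (ENNReal.ofReal (t ^ d))⁻¹ * a ≤ b := by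
    intro t ht a b hab
    have h0 : ENNReal.ofReal (t ^ d) ≠ 0 := by
      rw [Ne, ENNReal.ofReal_eq_zero, not_le]; positivity
    calc (ENNReal.ofReal (t ^ d))⁻¹ * a ≤
          (ENNReal.ofReal (t ^ d))⁻¹ * (ENNReal.ofReal (t ^ d) * b) := by gcongr
      _ = b := by rw [← mul_assoc, ENNReal.inv_mul_cancel h0 ENNReal.ofReal_ne_top, one_mul]
  rw [ballPotential, ← Set.Ioc_union_Ioi_eq_Ioi hR.le]
  refine (lintegral_union_le _ _ _).trans ?_
  gcongr
  · calc _ ≤ ∫⁻ _ in Set.Ioc 0 R, P :=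
          setLIntegral_mono_ae' measurableSet_Ioc
            (.of_forall fun t ht => hcancel t ht.1 _ _ (hP t ht.1))
      _ = P * ENNReal.ofReal R := by simp
  · calc _ ≤ ∫⁻ t in Set.Ioi R, Q * ENNReal.ofReal (t ^ (-r)) :=
          setLIntegral_mono_ae' measurableSet_Ioi (.of_forall fun t ht =>
            hcancel t (hR.trans ht) _ _ (hQ t (hR.trans ht)))
      _ = _ := by
          rw [lintegral_const_mul _ (by fun_prop), lintegral_Ioi_rpow_neg hr hR]

end BallPotential

section Morrey

variable {d : ℕ}

theorem ae_eq_zero_of_setLIntegral_ball_eq_zero {g : EuclideanSpace ℝ (Fin d) → ℝ≥0∞}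
    (hg : Measurable g) (x : EuclideanSpace ℝ (Fin d))
    (h : ∀ t, 0 < t → ∫⁻ y in ball x t, g y = 0) : g =ᵐ[volume] 0 := by
  rw [← lintegral_eq_zero_iff hg, ← setLIntegral_univ, ← iUnion_ball_nat_succ x]
  refine le_antisymm ((lintegral_iUnion_le _ _).trans ?_) (zero_le)
  rw [ENNReal.tsum_eq_zero.2 fun n => h _ (by positivity)]

theorem maxFun_ne_zero {g : EuclideanSpace ℝ (Fin d) → ℝ≥0∞} (hg : Measurable g)
    (hg0 : ¬ g =ᵐ[volume] 0) (x : EuclideanSpace ℝ (Fin d)) : maxFun g x ≠ 0 := fun h =>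
  hg0 <| ae_eq_zero_of_setLIntegral_ball_eq_zero hg x fun t ht => by
    simpa [h] using setLIntegral_ball_le_maxFun g (mem_ball_self (x := x) ht)

theorem setLIntegral_ball_le_of_morrey {g : EuclideanSpace ℝ (Fin d) → ℝ≥0∞} {A p : ℝ}
    (hA : 0 ≤ A) (hp : 0 ≤ p)
    (hg : ∀ (x : EuclideanSpace ℝ (Fin d)) (ρ : ℝ), 0 < ρ →
      ∫⁻ y in ball x ρ, g y ≤ ENNReal.ofReal (A ^ p * ρ ^ ((d : ℝ) - p)))
    (x : EuclideanSpace ℝ (Fin d)) {t s : ℝ} (ht : 0 < t) (hts : t ≤ s) :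
    ∫⁻ y in ball x s, g y ≤ ENNReal.ofReal (A ^ p * t ^ (-p)) *
      (volume (ball (0 : EuclideanSpace ℝ (Fin d)) 1))⁻¹ * volume (ball x s) := by
  have hs : 0 < s := ht.trans_le hts
  refine (hg x s hs).trans ?_
  rw [volume_ball_eq _ hs, mul_comm (ENNReal.ofReal (s ^ d)), mul_assoc, ← mul_assoc _⁻¹,
    ENNReal.inv_mul_cancel (measure_ball_pos _ _ one_pos).ne' measure_ball_lt_top.ne, one_mul,
    ← ENNReal.ofReal_mul (by positivity)]
  refine ENNReal.ofReal_le_ofReal ?_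
  rw [sub_eq_add_neg, Real.rpow_add hs, Real.rpow_natCast, mul_comm (s ^ d), ← mul_assoc]
  have : s ^ (-p) ≤ t ^ (-p) := Real.rpow_le_rpow_of_nonpos ht hts (by linarith)
  gcongr

/-- The weight `(maxFun g) ^ (r / p)` built from a Morrey function is locally integrable and
its potential is bounded by a power of the weight itself. -/
theorem exists_ballPotential_maxFun_rpow_le (hd : d ≠ 0) {r p : ℝ} (hr : 1 < r) (hrp : r < p) :
    ∃ C : ℝ≥0∞, C ≠ ∞ ∧ ∀ (g : EuclideanSpace ℝ (Fin d) → ℝ≥0∞) (A : ℝ), Measurable g →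
      ¬ g =ᵐ[volume] 0 → 0 < A →
      (∀ (x : EuclideanSpace ℝ (Fin d)) (ρ : ℝ), 0 < ρ →
        ∫⁻ y in ball x ρ, g y ≤ ENNReal.ofReal (A ^ p * ρ ^ ((d : ℝ) - p))) →
      ∀ x, (∀ t, 0 < t → ∫⁻ y in ball x t, maxFun g y ^ (r / p) ≠ ∞) ∧
        ballPotential (fun y => maxFun g y ^ (r / p)) x ≤
          C * ENNReal.ofReal A * (maxFun g x ^ (r / p)) ^ ((r - 1) / r) := by
  have hr0 : 0 < r := one_pos.trans hr
  have hp0 : 0 < p := hr0.trans hrp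
  have hr1 : 0 < r - 1 := sub_pos.2 hr
  have hδ : 0 < r / p := by positivity
  obtain ⟨C₀, hC₀, hkol⟩ := exists_setLIntegral_ball_maxFun_rpow_le hd hδ
    ((div_lt_one hp0).2 hrp)
  set ω := volume (ball (0 : EuclideanSpace ℝ (Fin d)) 1)
  have hω0 : ω ≠ 0 := (measure_ball_pos _ _ one_pos).ne'
  have hω : ω ≠ ∞ := measure_ball_lt_top.ne
  have hωδ : (ω⁻¹) ^ (r / p) ≠ ∞ :=
    ENNReal.rpow_ne_top_of_nonneg hδ.le (ENNReal.inv_ne_top.2 hω0)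
  refine ⟨C₀ * ω + C₀ * ω * (ω⁻¹) ^ (r / p) * ENNReal.ofReal (1 / (r - 1)) + 1, ?_, ?_⟩
  · have h1 : C₀ * ω ≠ ∞ := ENNReal.mul_ne_top hC₀ hω
    have h2 : C₀ * ω * (ω⁻¹) ^ (r / p) * ENNReal.ofReal (1 / (r - 1)) ≠ ∞ :=
      ENNReal.mul_ne_top (ENNReal.mul_ne_top h1 hωδ) ENNReal.ofReal_ne_top
    exact ENNReal.add_ne_top.2 ⟨ENNReal.add_ne_top.2 ⟨h1, h2⟩, ENNReal.one_ne_top⟩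
  intro g A hgm hg0 hA hg x
  have hQ : ∀ t, 0 < t → ∫⁻ y in ball x t, maxFun g y ^ (r / p) ≤ ENNReal.ofReal (t ^ d) *
      (C₀ * ω * (ω⁻¹) ^ (r / p) * ENNReal.ofReal (A ^ r) * ENNReal.ofReal (t ^ (-r))) := by
    intro t ht
    have hpos : 0 < A ^ p * t ^ (-p) := by positivity
    refine (hkol g x t (ENNReal.ofReal (A ^ p * t ^ (-p)) * ω⁻¹) ht
      (mul_ne_zero (ENNReal.ofReal_pos.2 hpos).ne' (ENNReal.inv_ne_zero.2 hω))
      (ENNReal.mul_ne_top ENNReal.ofReal_ne_top (ENNReal.inv_ne_top.2 hω0))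
      fun s hs => setLIntegral_ball_le_of_morrey hA.le hp0.le hg x ht hs).trans_eq ?_
    have hpow : (A ^ p * t ^ (-p)) ^ (r / p) = A ^ r * t ^ (-r) := by
      rw [Real.mul_rpow (by positivity) (by positivity), ← Real.rpow_mul hA.le,
        ← Real.rpow_mul ht.le, mul_div_cancel₀ _ hp0.ne', neg_mul, mul_div_cancel₀ _ hp0.ne']
    rw [ENNReal.mul_rpow_of_nonneg _ _ hδ.le, ENNReal.ofReal_rpow_of_pos hpos, hpow,
      ENNReal.ofReal_mul (by positivity), volume_ball_eq _ ht]
    ring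
  refine ⟨fun t ht => ne_top_of_le_ne_top ?_ (hQ t ht), ?_⟩
  · exact ENNReal.mul_ne_top ENNReal.ofReal_ne_top (ENNReal.mul_ne_top (ENNReal.mul_ne_top
      (ENNReal.mul_ne_top (ENNReal.mul_ne_top hC₀ hω) hωδ) ENNReal.ofReal_ne_top)
      ENNReal.ofReal_ne_top)
  have hm0 := maxFun_ne_zero hgm hg0 x
  rcases eq_or_ne (maxFun g x) ∞ with hm | hm
  · rw [hm, ENNReal.top_rpow_of_pos hδ, ENNReal.top_rpow_of_pos (by positivity),
      ENNReal.mul_top (mul_ne_zero (by simp) (ENNReal.ofReal_pos.2 hA).ne')]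
    exact le_top
  have hP : ∀ t, 0 < t → ∫⁻ y in ball x t, maxFun g y ^ (r / p) ≤ ENNReal.ofReal (t ^ d) *
      (C₀ * ω * maxFun g x ^ (r / p)) := by
    intro t ht
    refine (hkol g x t (maxFun g x) ht hm0 hm fun s hs =>
      setLIntegral_ball_le_maxFun g (mem_ball_self (ht.trans_le hs))).trans_eq ?_
    rw [volume_ball_eq _ ht]
    ring
  obtain ⟨w, hw, hwm⟩ : ∃ w : ℝ, 0 < w ∧ maxFun g x ^ (r / p) = ENNReal.ofReal w := by
    have htop : maxFun g x ^ (r / p) ≠ ∞ := ENNReal.rpow_ne_top_of_nonneg hδ.le hm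
    refine ⟨(maxFun g x ^ (r / p)).toReal, ENNReal.toReal_pos ?_ htop,
      (ENNReal.ofReal_toReal htop).symm⟩
    exact (ENNReal.rpow_pos (pos_iff_ne_zero.2 hm0) hm).ne'
  set R := A * w ^ (-1 / r)
  have hR : 0 < R := by positivity
  have h1 : w * R = A * w ^ ((r - 1) / r) := by
    rw [show (r - 1) / r = 1 + -1 / r by field_simp; ring, Real.rpow_add hw, Real.rpow_one]
    ring
  have h2 : A ^ r * (R ^ (1 - r) / (r - 1)) = 1 / (r - 1) * (A * w ^ ((r - 1) / r)) := by
    rw [Real.mul_rpow hA.le (by positivity), ← Real.rpow_mul hw.le,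
      show -1 / r * (1 - r) = (r - 1) / r by ring, show A ^ (1 - r) = A / A ^ r by
        rw [Real.rpow_sub hA, Real.rpow_one]]
    have : A ^ r ≠ 0 := by positivity
    field_simp
  refine (ballPotential_le hr hR hP hQ).trans ?_
  rw [hwm, ENNReal.ofReal_rpow_of_pos hw]
  calc C₀ * ω * ENNReal.ofReal w * ENNReal.ofReal R +
        C₀ * ω * ω⁻¹ ^ (r / p) * ENNReal.ofReal (A ^ r) * ENNReal.ofReal (R ^ (1 - r) / (r - 1))
      = C₀ * ω * ENNReal.ofReal (w * R) +
        C₀ * ω * ω⁻¹ ^ (r / p) * ENNReal.ofReal (A ^ r * (R ^ (1 - r) / (r - 1))) := by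
        rw [ENNReal.ofReal_mul hw.le, ENNReal.ofReal_mul (p := A ^ r) (by positivity)]
        ring
    _ = (C₀ * ω + C₀ * ω * (ω⁻¹) ^ (r / p) * ENNReal.ofReal (1 / (r - 1))) *
        (ENNReal.ofReal A * ENNReal.ofReal (w ^ ((r - 1) / r))) := by
        rw [h1, h2, ENNReal.ofReal_mul (p := 1 / (r - 1)) (by positivity),
          ← ENNReal.ofReal_mul hA.le]
        ring
    _ ≤ _ := by
        refine le_of_le_of_eq ?_ (mul_assoc _ _ _).symm
        exact mul_le_mul' le_self_add le_rfl

theorem le_rpow_mul_of_mul_le {r : ℝ} (hr : 1 < r) {ω D X Y : ℝ≥0∞} (hω0 : ω ≠ 0) (hω : ω ≠ ∞)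
    (hX : X ≠ ∞) (h : ω * X ≤ D * (X ^ ((r - 1) / r) * Y ^ (1 / r))) : X ≤ (D / ω) ^ r * Y := by
  have hr0 : 0 < r := one_pos.trans hr
  rcases eq_or_ne X 0 with rfl | hX0
  · exact zero_le
  have hc0 : X ^ ((r - 1) / r) ≠ 0 := (ENNReal.rpow_pos (pos_iff_ne_zero.2 hX0) hX).ne'
  have hc : X ^ ((r - 1) / r) ≠ ∞ :=
    ENNReal.rpow_ne_top_of_nonneg (div_nonneg (by linarith) hr0.le) hX
  have hsplit : X = X ^ ((r - 1) / r) * X ^ (1 / r) := by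
    rw [← ENNReal.rpow_add _ _ hX0 hX, ← add_div, sub_add_cancel, div_self hr0.ne',
      ENNReal.rpow_one]
  have h1 : X ^ ((r - 1) / r) * (ω * X ^ (1 / r)) ≤ X ^ ((r - 1) / r) * (D * Y ^ (1 / r)) := by
    calc _ = ω * X := by conv_rhs => rw [hsplit]
                         ring
      _ ≤ _ := h
      _ = _ := by ring
  rw [ENNReal.mul_le_mul_iff_right hc0 hc] at h1
  have h2 : X ^ (1 / r) ≤ D / ω * Y ^ (1 / r) := by
    rw [← ENNReal.mul_div_right_comm, ENNReal.le_div_iff_mul_le (Or.inl hω0) (Or.inl hω), mul_comm]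
    exact h1
  have h3 := ENNReal.rpow_le_rpow h2 hr0.le
  rwa [ENNReal.mul_rpow_of_nonneg _ _ hr0.le, ← ENNReal.rpow_mul, ← ENNReal.rpow_mul,
    one_div_mul_cancel hr0.ne', ENNReal.rpow_one, ENNReal.rpow_one] at h3

/-- If the potential of a weight `W` is bounded by `D * W ^ ((r - 1) / r)`, then `W` satisfies
a Hardy type inequality. -/
theorem lintegral_weight_mul_rpow_le (hd : d ≠ 0) {r : ℝ} (hr : 1 < r)
    {W : EuclideanSpace ℝ (Fin d) → ℝ≥0∞} (hW : Measurable W) {D : ℝ≥0∞}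
    (hWfin : ∀ x t, 0 < t → ∫⁻ y in ball x t, W y ≠ ∞)
    (hWD : ∀ x, ballPotential W x ≤ D * W x ^ ((r - 1) / r))
    {u : EuclideanSpace ℝ (Fin d) → ℝ} (hu : ContDiff ℝ 1 u) (hu' : HasCompactSupport u) :
    ∫⁻ x, W x * ‖u x‖ₑ ^ r ≤
      (ENNReal.ofReal r * D / volume (ball (0 : EuclideanSpace ℝ (Fin d)) 1)) ^ r *
        ∫⁻ x, ‖fderiv ℝ u x‖ₑ ^ r := by
  have hr0 : 0 < r := one_pos.trans hr
  set ω := volume (ball (0 : EuclideanSpace ℝ (Fin d)) 1)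
  have hω0 : ω ≠ 0 := (measure_ball_pos _ _ one_pos).ne'
  have hω : ω ≠ ∞ := measure_ball_lt_top.ne
  have hfin : ∫⁻ x, W x * ‖u x‖ₑ ^ r ≠ ∞ := by
    obtain ⟨M, hM⟩ := hu'.exists_bound_of_continuous hu.continuous
    obtain ⟨t, ht, hsupp⟩ := hu'.isCompact.isBounded.subset_ball_lt 0 0
    refine ne_top_of_le_ne_top (ENNReal.mul_ne_top (hWfin 0 t ht)
      (ENNReal.rpow_ne_top_of_nonneg hr0.le (ENNReal.ofReal_ne_top (r := M)))) ?_
    rw [← lintegral_mul_const _ hW, ← lintegral_indicator measurableSet_ball]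
    refine lintegral_mono fun x => ?_
    by_cases hx : x ∈ ball 0 t
    · rw [Set.indicator_of_mem hx]
      gcongr
      rw [← ofReal_norm]
      exact ENNReal.ofReal_le_ofReal (hM x)
    · have : u x = 0 := image_eq_zero_of_notMem_tsupport fun h => hx (hsupp h)
      simp [this, hr0]
  refine le_rpow_mul_of_mul_le hr hω0 hω hfin ?_
  set v : EuclideanSpace ℝ (Fin d) → ℝ := fun x => ‖u x‖ ^ r
  have hv : ContDiff ℝ 1 v := hu.norm_rpow hr
  have hv' : HasCompactSupport v :=
    hu'.comp_left (g := fun y : ℝ => ‖y‖ ^ r) (by simp [hr0.ne'])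
  have hvn : ∀ x, ‖v x‖ₑ = ‖u x‖ₑ ^ r := fun x => by
    rw [← ofReal_norm, ← ofReal_norm, ENNReal.ofReal_rpow_of_nonneg (norm_nonneg _) hr0.le,
      Real.norm_of_nonneg (Real.rpow_nonneg (norm_nonneg _) _)]
  have hDv : ∀ x, ‖fderiv ℝ v x‖ₑ ≤ ENNReal.ofReal r * ‖u x‖ₑ ^ (r - 1) * ‖fderiv ℝ u x‖ₑ := by
    intro x
    have h := norm_fderiv_norm_rpow_le (hu.differentiable one_ne_zero) (x := x) hr
    rw [← ofReal_norm, ← ofReal_norm, ← ofReal_norm,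
      ENNReal.ofReal_rpow_of_nonneg (norm_nonneg _) (by linarith), ← ENNReal.ofReal_mul hr0.le,
      ← ENNReal.ofReal_mul (by positivity)]
    exact ENNReal.ofReal_le_ofReal h
  have hcu : Measurable fun x => ‖u x‖ₑ := hu.continuous.enorm.measurable
  have hcDu : Measurable fun x => ‖fderiv ℝ u x‖ₑ :=
    (hu.continuous_fderiv one_ne_zero).enorm.measurable
  have hcDv : Measurable fun x => ‖fderiv ℝ v x‖ₑ :=
    (hv.continuous_fderiv one_ne_zero).enorm.measurable
  have hconj : (r / (r - 1)).HolderConjugate r :=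
    (Real.HolderConjugate.conjExponent hr).symm
  calc ω * ∫⁻ x, W x * ‖u x‖ₑ ^ r = ∫⁻ x, W x * (‖v x‖ₑ * ω) := by
        rw [← lintegral_const_mul _ (by fun_prop)]
        exact lintegral_congr fun x => by rw [hvn]; ring
    _ ≤ ∫⁻ x, W x * ballPotential (fun y => ‖fderiv ℝ v y‖ₑ) x := by
        gcongr with x
        exact enorm_mul_volume_le_ballPotential hd hv hv' x
    _ = ∫⁻ x, ‖fderiv ℝ v x‖ₑ * ballPotential W x := lintegral_mul_ballPotential_comm hW hcDv
    _ ≤ ∫⁻ x, ENNReal.ofReal r * D *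
          ((W x * ‖u x‖ₑ ^ r) ^ ((r - 1) / r) * ‖fderiv ℝ u x‖ₑ) := by
        refine lintegral_mono fun x => (mul_le_mul' (hDv x) (hWD x)).trans_eq ?_
        rw [ENNReal.mul_rpow_of_nonneg _ _ (div_nonneg (by linarith) hr0.le),
          ← ENNReal.rpow_mul, mul_div_cancel₀ _ hr0.ne']
        ring
    _ = ENNReal.ofReal r * D * ∫⁻ x, (W x * ‖u x‖ₑ ^ r) ^ ((r - 1) / r) * ‖fderiv ℝ u x‖ₑ :=
        lintegral_const_mul _ (by fun_prop)
    _ ≤ _ := by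
        gcongr
        have h := ENNReal.lintegral_mul_le_Lp_mul_Lq (volume : Measure (EuclideanSpace ℝ (Fin d)))
          hconj (f := fun x => (W x * ‖u x‖ₑ ^ r) ^ ((r - 1) / r)) (g := fun x => ‖fderiv ℝ u x‖ₑ)
          (by fun_prop) hcDu.aemeasurable
        have hpow : ∀ x, ((W x * ‖u x‖ₑ ^ r) ^ ((r - 1) / r)) ^ (r / (r - 1)) =
            W x * ‖u x‖ₑ ^ r := fun x => by
          rw [← ENNReal.rpow_mul, div_mul_div_cancel₀ hr0.ne', div_self (by linarith),
            ENNReal.rpow_one]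
        simpa only [hpow, one_div_div, Pi.mul_apply] using h

end Morrey

/-- **Chiarenza–Frasca theorem.** If `d ≥ 2`, `1 ≤ r`, `1 < r < p ≤ d`, and `b ≥ 0`
satisfies `∫_B b^p ≤ A^p ρ^(d-p)` on every ball of radius `ρ`, then for every
`u ∈ C_0^∞(ℝ^d)`, `∫ b^r |u|^r ≤ N A^r ∫ |Du|^r` with `N = N(d,r,p)`. -/
theorem chiarenza_frasca
    (d : ℕ) (hd : 2 ≤ d) (r p : ℝ) (hr1 : 1 ≤ r) (hr : 1 < r) (hrp : r < p)
    (hpd : p ≤ d) :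
    ∃ N : ℝ, 0 < N ∧
      ∀ b : EuclideanSpace ℝ (Fin d) → ℝ, Measurable b → (∀ x, 0 ≤ b x) →
      ∀ A : ℝ, 0 ≤ A →
      (∀ (x : EuclideanSpace ℝ (Fin d)) (ρ : ℝ), 0 < ρ →
        ∫⁻ y in ball x ρ, ENNReal.ofReal (b y ^ p) ≤
          ENNReal.ofReal (A ^ p * ρ ^ ((d : ℝ) - p))) →
      ∀ u : EuclideanSpace ℝ (Fin d) → ℝ, ContDiff ℝ (⊤ : ℕ∞) u → HasCompactSupport u →
      ∫⁻ x, ENNReal.ofReal (b x ^ r * |u x| ^ r) ≤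
        ENNReal.ofReal (N * A ^ r) * ∫⁻ x, ENNReal.ofReal (‖fderiv ℝ u x‖ ^ r) := by
  have hd0 : d ≠ 0 := by omega
  have hr0 : 0 < r := one_pos.trans hr
  have hp0 : 0 < p := hr0.trans hrp
  obtain ⟨C, hC, hpot⟩ := exists_ballPotential_maxFun_rpow_le hd0 hr hrp
  set ω := volume (ball (0 : EuclideanSpace ℝ (Fin d)) 1)
  have hω0 : ω ≠ 0 := (measure_ball_pos _ _ one_pos).ne'
  set c := (ENNReal.ofReal r * C / ω) ^ r
  have hc : c ≠ ∞ := ENNReal.rpow_ne_top_of_nonneg hr0.le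
    (ENNReal.div_ne_top (ENNReal.mul_ne_top ENNReal.ofReal_ne_top hC) hω0)
  refine ⟨c.toReal + 1, by positivity, ?_⟩
  intro b hb hb0 A hA hbA u hu hu'
  set g : EuclideanSpace ℝ (Fin d) → ℝ≥0∞ := fun x => ENNReal.ofReal (b x ^ p)
  have hg : Measurable g := by fun_prop
  by_cases hg0 : g =ᵐ[volume] 0
  · refine le_of_eq_of_le ?_ (zero_le)
    rw [lintegral_eq_zero_iff' ?_]
    · filter_upwards [hg0] with x hx
      have h1 : b x ^ p = 0 :=
        le_antisymm (ENNReal.ofReal_eq_zero.1 hx) (Real.rpow_nonneg (hb0 x) p)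
      have h2 : b x = 0 := (Real.rpow_eq_zero (hb0 x) hp0.ne').1 h1
      simp [h2, Real.zero_rpow hr0.ne']
    · have := hu.continuous.measurable
      fun_prop
  have hApos : 0 < A := by
    refine lt_of_le_of_ne hA fun hA0 => hg0 ?_
    refine ae_eq_zero_of_setLIntegral_ball_eq_zero hg 0 fun t ht => ?_
    have h := hbA 0 t ht
    rw [← hA0, Real.zero_rpow hp0.ne', zero_mul, ENNReal.ofReal_zero] at h
    exact le_antisymm h (zero_le)
  have hW := hpot g A hg hg0 hApos hbA
  have hhardy := lintegral_weight_mul_rpow_le hd0 hr ((measurable_maxFun g).pow_const (r / p))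
    (fun x => (hW x).1) (fun x => (hW x).2)
    (hu.of_le (by exact_mod_cast le_top)) hu'
  have hgfin : ∀ x, ∃ t, 0 < t ∧ ∫⁻ y in ball x t, g y ≠ ∞ := fun x =>
    ⟨1, one_pos, ne_top_of_le_ne_top ENNReal.ofReal_ne_top (hbA x 1 one_pos)⟩
  calc ∫⁻ x, ENNReal.ofReal (b x ^ r * |u x| ^ r)
      ≤ ∫⁻ x, maxFun g x ^ (r / p) * ‖u x‖ₑ ^ r := by
        refine lintegral_mono_ae ?_
        filter_upwards [ae_le_maxFun hg hgfin] with x hx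
        have hbr : ENNReal.ofReal (b x ^ r) = g x ^ (r / p) := by
          rw [ENNReal.ofReal_rpow_of_nonneg (Real.rpow_nonneg (hb0 x) p) (by positivity),
            ← Real.rpow_mul (hb0 x), mul_div_cancel₀ _ hp0.ne']
        rw [ENNReal.ofReal_mul (Real.rpow_nonneg (hb0 x) r), hbr, ← Real.norm_eq_abs,
          ← ENNReal.ofReal_rpow_of_nonneg (norm_nonneg _) hr0.le, ofReal_norm]
        gcongr
    _ ≤ _ := hhardy
    _ ≤ ENNReal.ofReal ((c.toReal + 1) * A ^ r) * ∫⁻ x, ‖fderiv ℝ u x‖ₑ ^ r := by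
        gcongr
        rw [← mul_assoc, ENNReal.mul_div_right_comm, ENNReal.mul_rpow_of_nonneg _ _ hr0.le,
          ENNReal.ofReal_mul (by positivity), ENNReal.ofReal_rpow_of_nonneg hA hr0.le]
        gcongr
        exact ENNReal.le_ofReal_iff_toReal_le hc (by positivity) |>.2 (by linarith)
    _ = _ := by
        congr 1
        refine lintegral_congr fun x => ?_
        rw [← ENNReal.ofReal_rpow_of_nonneg (norm_nonneg _) hr0.le, ofReal_norm]
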